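/- arXiv:2601.15580 — 7 statements merged into one kernel-verified Lean document; each statement's English description precedes it below -/
import Mathlib

section
/- Fix a type 𝒯, an element t0 ∈ 𝒯, and a set T0 ⊆ 𝒯 with t0 ∈ T0. Let C assign to every subset S ⊆ 𝒯 a nonempty compact set C(S) ⊆ ℝ² such that S ⊆ S' implies C(S) ⊆ C(S'). Let ubar = min{u : (u,v) ∈ C({t0})} (attained by compactness). Then the supremum, over all incentive-compatible mechanisms a, of the second coordinate of a(T0) equals max{v : (u,v) ∈ conv(C(T0)) and u ≥ ubar}, and this maximum is attained. -/
open Set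

/-- The convex hull of a compact set in the plane is compact (via Carathéodory). -/
theorem isCompact_hull_aux {s : Set (ℝ × ℝ)} (hs : IsCompact s) :
    IsCompact (convexHull ℝ s) := by
  have h : convexHull ℝ s = ⋃ k ∈ Set.Iic (Module.finrank ℝ (ℝ × ℝ) + 1),
      (fun q : (Fin k → ℝ) × (Fin k → ℝ × ℝ) => ∑ i, q.1 i • q.2 i) ''
        (stdSimplex ℝ (Fin k) ×ˢ Set.univ.pi (fun _ => s)) := by
    ext x
    simp only [Set.mem_iUnion]
    constructor
    · intro hx
      obtain ⟨ι, _, z, w, hz, hai, hw, hw1, hx⟩ := eq_pos_convex_span_of_mem_convexHull hx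
      let e := (Fintype.equivFin ι).symm
      refine ⟨Fintype.card ι, ?_, (w ∘ e, z ∘ e), ⟨⟨fun i => (hw _).le, ?_⟩, ?_⟩, ?_⟩
      · exact hai.card_le_finrank_succ.trans
          (Nat.add_le_add_right (Submodule.finrank_le _) 1)
      · rw [← hw1]
        exact e.sum_comp w
      · intro i _
        exact hz ⟨_, rfl⟩
      · rw [← hx]
        exact e.sum_comp (fun i => w i • z i)
    · rintro ⟨k, -, q, ⟨hq1, hq2⟩, rfl⟩
      exact (convex_convexHull ℝ s).sum_mem (fun i _ => hq1.1 i) hq1.2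
        (fun i _ => subset_convexHull ℝ s (hq2 i trivial))
  rw [h]
  refine (Set.finite_Iic _).isCompact_biUnion fun k _ => ?_
  refine IsCompact.image ?_ (by fun_prop)
  exact (isCompact_stdSimplex ℝ (Fin k)).prod (isCompact_univ_pi fun _ => hs)

/-- In the complete-information benchmark, the supremum over all
incentive-compatible mechanisms of the principal's payoff at the true type `T0`
equals the maximum of `v` over `{(u,v) ∈ conv(C(T0)) : u ≥ ubar}`, and this
maximum is attained. A report is a set `S` with `t0 ∈ S ⊆ T0`; a mechanism maps
each report `S` to a point of `conv(C(S))`; incentive compatibility means the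
agent's payoff at `T0` is at least his payoff at any report. -/
theorem stmt0 {𝒯 : Type*} (t0 : 𝒯) (T0 : Set 𝒯) (ht0 : t0 ∈ T0)
    (C : Set 𝒯 → Set (ℝ × ℝ))
    (hne : ∀ S : Set 𝒯, (C S).Nonempty)
    (hcpt : ∀ S : Set 𝒯, IsCompact (C S))
    (hmono : ∀ S S' : Set 𝒯, S ⊆ S' → C S ⊆ C S')
    (ubar : ℝ) (hubar : IsLeast (Prod.fst '' C {t0}) ubar) :
    IsGreatest {v : ℝ | ∃ u : ℝ, (u, v) ∈ convexHull ℝ (C T0) ∧ ubar ≤ u}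
      (sSup {w : ℝ | ∃ a : Set 𝒯 → ℝ × ℝ,
        (∀ S : Set 𝒯, t0 ∈ S → S ⊆ T0 → a S ∈ convexHull ℝ (C S)) ∧
        (∀ S : Set 𝒯, t0 ∈ S → S ⊆ T0 → (a S).1 ≤ (a T0).1) ∧
        w = (a T0).2}) := by
  classical
  have hsub : C {t0} ⊆ C T0 := hmono _ _ (Set.singleton_subset_iff.2 ht0)
  have hhalf : Convex ℝ {p : ℝ × ℝ | ubar ≤ p.1} :=
    convex_halfSpace_ge (LinearMap.fst ℝ ℝ ℝ).isLinear ubar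
  have hlow : ∀ p ∈ convexHull ℝ (C {t0}), ubar ≤ p.1 := by
    intro p hp
    exact convexHull_min (fun q hq => hubar.2 ⟨q, hq, rfl⟩) hhalf hp
  obtain ⟨⟨p, hp, hpu⟩, -⟩ := hubar
  have heq : {w : ℝ | ∃ a : Set 𝒯 → ℝ × ℝ,
        (∀ S : Set 𝒯, t0 ∈ S → S ⊆ T0 → a S ∈ convexHull ℝ (C S)) ∧
        (∀ S : Set 𝒯, t0 ∈ S → S ⊆ T0 → (a S).1 ≤ (a T0).1) ∧
        w = (a T0).2} =
      {v : ℝ | ∃ u : ℝ, (u, v) ∈ convexHull ℝ (C T0) ∧ ubar ≤ u} := by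
    ext w
    constructor
    · rintro ⟨a, h1, h2, rfl⟩
      have hs : ({t0} : Set 𝒯) ⊆ T0 := Set.singleton_subset_iff.2 ht0
      exact ⟨(a T0).1, h1 T0 ht0 subset_rfl,
        (hlow _ (h1 {t0} rfl hs)).trans (h2 {t0} rfl hs)⟩
    · rintro ⟨u, hu, hle⟩
      refine ⟨fun S => if S = T0 then (u, w) else p, ?_, ?_, ?_⟩
      · intro S hS _
        by_cases h : S = T0
        · subst h
          simpa using hu
        · simp only [h, if_false]
          exact subset_convexHull ℝ _ (hmono _ _ (Set.singleton_subset_iff.2 hS) hp)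
      · intro S _ _
        by_cases h : S = T0
        · simp [h]
        · simp only [h, if_false, if_true]
          exact hpu.le.trans hle
      · simp
  rw [heq]
  have himg : {v : ℝ | ∃ u : ℝ, (u, v) ∈ convexHull ℝ (C T0) ∧ ubar ≤ u} =
      Prod.snd '' (convexHull ℝ (C T0) ∩ {p : ℝ × ℝ | ubar ≤ p.1}) := by
    ext v
    simp
  have hK : IsCompact (convexHull ℝ (C T0) ∩ {p : ℝ × ℝ | ubar ≤ p.1}) :=
    (isCompact_hull_aux (hcpt T0)).inter_right (isClosed_le continuous_const continuous_fst)
  rw [himg]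
  exact (hK.image continuous_snd).isGreatest_sSup
    ⟨p.2, p, ⟨subset_convexHull ℝ _ (hsub hp), hpu.ge⟩, rfl⟩
end

section
/- Let D ⊆ ℝ² be nonempty, compact and convex, and let ubar ∈ ℝ satisfy ubar ≤ max{u : (u,v) ∈ D}. Suppose (u*,v*) ∈ D is the unique maximizer of the second coordinate over D, i.e. for every (u,v) ∈ D one has v ≤ v*, with equality only if (u,v) = (u*,v*). Then every maximizer (u0,v0) of the second coordinate over the set {(u,v) ∈ D : u ≥ ubar} satisfies u0 = max(ubar, u*). -/
open Set

/-- If `D ⊆ ℝ²` is nonempty, compact and convex, `ubar` does not exceed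
the maximal first coordinate over `D`, and `(u*, v*)` is the unique maximizer of the
second coordinate over `D`, then every maximizer of the second coordinate over
`{(u,v) ∈ D : u ≥ ubar}` has first coordinate `max ubar u*`. -/
theorem stmt1 (D : Set (ℝ × ℝ)) (hne : D.Nonempty) (hcpt : IsCompact D)
    (hconv : Convex ℝ D)
    (ubar : ℝ) (hub : ∃ p ∈ D, ubar ≤ p.1)
    (ustar vstar : ℝ) (hmem : (ustar, vstar) ∈ D)
    (hmax : ∀ p ∈ D, p.2 ≤ vstar)
    (huniq : ∀ p ∈ D, p.2 = vstar → p = (ustar, vstar))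
    (u0 v0 : ℝ) (h0mem : (u0, v0) ∈ D) (h0u : ubar ≤ u0)
    (h0max : ∀ p ∈ D, ubar ≤ p.1 → p.2 ≤ v0) :
    u0 = max ubar ustar := by
  have key : vstar ≤ v0 → u0 = ustar := fun h => by
    have h1 : v0 = vstar := le_antisymm (hmax _ h0mem) h
    have h2 := huniq _ h0mem h1
    exact congrArg Prod.fst h2
  rcases le_or_gt ubar ustar with h | h
  · rw [max_eq_right h]
    exact key (h0max _ hmem h)
  · rw [max_eq_left h.le]
    by_contra hne'
    have hlt : ubar < u0 := lt_of_le_of_ne h0u (Ne.symm hne')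
    have hd : 0 < u0 - ustar := by linarith
    obtain ⟨t, ht⟩ : ∃ t, t = (ubar - ustar) / (u0 - ustar) := ⟨_, rfl⟩
    have ht0 : 0 ≤ t := by rw [ht]; exact div_nonneg (by linarith) hd.le
    have ht1 : t < 1 := by rw [ht, div_lt_one hd]; linarith
    have hm : t * (u0 - ustar) = ubar - ustar := by rw [ht]; field_simp
    have hp := hconv hmem h0mem (by linarith : 0 ≤ 1 - t) ht0 (by ring)
    have hle := h0max _ hp (by simp; linarith)
    simp at hle
    have hv : vstar ≤ v0 := by
      by_contra hc
      push Not at hc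
      nlinarith [mul_pos (sub_pos.2 ht1) (sub_pos.2 hc)]
    linarith [key hv]
end

section
/- Let lf, uf, u_c : [0,1] → ℝ with uf weakly increasing and lf(T) ≤ u_c(T) ≤ uf(T) for all T. For each T ∈ [0,1] let V(T,·) : ℝ → ℝ be concave on [lf(T), uf(T)] with V(T, u_c(T)) ≥ V(T,u) for all u ∈ [lf(T), uf(T)]. Define the upper monotone closure ūc(T) = sup{u_c(s) : 0 ≤ s ≤ T} and the lower monotone closure ǔc(T) = inf{u_c(s) : T ≤ s ≤ 1}, and assume these are finite for all T. Let U : [0,1] → ℝ be weakly increasing with lf(T) ≤ U(T) ≤ uf(T) for all T, and define Û(T) = max(ǔc(T), min(ūc(T), U(T))). Then Û is weakly increasing, ǔc(T) ≤ Û(T) ≤ ūc(T) for all T, and V(T, Û(T)) ≥ V(T, U(T)) for all T. -/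
open Set

/-- Clamping a weakly increasing feasible promised utility `U` into
the monotone envelope of the complete-information curve `u_c`—that is, replacing
`U(T)` by `Û(T) = max(ǔc(T), min(ūc(T), U(T)))`, where
`ūc(T) = sup{u_c(s) : 0 ≤ s ≤ T}` and `ǔc(T) = inf{u_c(s) : T ≤ s ≤ 1}`—keeps it
weakly increasing, places it inside the monotone envelope, and weakly raises the
principal's payoff `V(T, ·)` pointwise, where `V(T, ·)` is concave on
`[lf(T), uf(T)]` and maximized at `u_c(T)`. -/
theorem stmt7 (lf uf uc : ℝ → ℝ)
    (huf : MonotoneOn uf (Icc (0:ℝ) 1))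
    (hfeas : ∀ T ∈ Icc (0:ℝ) 1, lf T ≤ uc T ∧ uc T ≤ uf T)
    (V : ℝ → ℝ → ℝ)
    (hVconc : ∀ T ∈ Icc (0:ℝ) 1, ConcaveOn ℝ (Icc (lf T) (uf T)) (V T))
    (hVmax : ∀ T ∈ Icc (0:ℝ) 1, ∀ u ∈ Icc (lf T) (uf T), V T u ≤ V T (uc T))
    (hbddAbove : ∀ T ∈ Icc (0:ℝ) 1, BddAbove (uc '' Icc 0 T))
    (hbddBelow : ∀ T ∈ Icc (0:ℝ) 1, BddBelow (uc '' Icc T 1))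
    (U : ℝ → ℝ) (hUmono : MonotoneOn U (Icc (0:ℝ) 1))
    (hUfeas : ∀ T ∈ Icc (0:ℝ) 1, lf T ≤ U T ∧ U T ≤ uf T) :
    MonotoneOn (fun T => max (sInf (uc '' Icc T 1)) (min (sSup (uc '' Icc 0 T)) (U T)))
      (Icc (0:ℝ) 1) ∧
    (∀ T ∈ Icc (0:ℝ) 1,
      sInf (uc '' Icc T 1)
          ≤ max (sInf (uc '' Icc T 1)) (min (sSup (uc '' Icc 0 T)) (U T)) ∧
      max (sInf (uc '' Icc T 1)) (min (sSup (uc '' Icc 0 T)) (U T))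
          ≤ sSup (uc '' Icc 0 T)) ∧
    (∀ T ∈ Icc (0:ℝ) 1,
      V T (U T) ≤ V T (max (sInf (uc '' Icc T 1)) (min (sSup (uc '' Icc 0 T)) (U T)))) := by
  have hlo : ∀ T ∈ Icc (0:ℝ) 1, sInf (uc '' Icc T 1) ≤ uc T := fun T hT =>
    csInf_le (hbddBelow T hT) (mem_image_of_mem _ ⟨le_rfl, hT.2⟩)
  have hhi : ∀ T ∈ Icc (0:ℝ) 1, uc T ≤ sSup (uc '' Icc 0 T) := fun T hT =>
    le_csSup (hbddAbove T hT) (mem_image_of_mem _ ⟨hT.1, le_rfl⟩)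
  refine ⟨?_, ?_, ?_⟩
  · intro S hS T hT hST
    have h1 : sInf (uc '' Icc S 1) ≤ sInf (uc '' Icc T 1) :=
      csInf_le_csInf (hbddBelow S hS) ⟨uc T, mem_image_of_mem _ ⟨le_rfl, hT.2⟩⟩
        (image_mono (Icc_subset_Icc_left hST))
    have h2 : sSup (uc '' Icc 0 S) ≤ sSup (uc '' Icc 0 T) :=
      csSup_le_csSup (hbddAbove T hT) ⟨uc S, mem_image_of_mem _ ⟨hS.1, le_rfl⟩⟩
        (image_mono (Icc_subset_Icc_right hST))
    exact max_le_max h1 (min_le_min h2 (hUmono hS hT hST))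
  · intro T hT
    exact ⟨le_max_left _ _, max_le ((hlo T hT).trans (hhi T hT)) (min_le_left _ _)⟩
  · intro T hT
    have h1 := hlo T hT
    have h2 := hhi T hT
    have hm := hVmax T hT (U T) (hUfeas T hT)
    rcases le_total (U T) (uc T) with h | h
    · have := (hVconc T hT).min_le_of_mem_Icc (hUfeas T hT) (hfeas T hT)
        (z := max (sInf (uc '' Icc T 1)) (min (sSup (uc '' Icc 0 T)) (U T)))
        ⟨(le_min (h.trans h2) le_rfl).trans (le_max_right _ _),
          max_le h1 ((min_le_right _ _).trans h)⟩
      rwa [min_eq_left hm] at this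
    · have := (hVconc T hT).min_le_of_mem_Icc (hfeas T hT) (hUfeas T hT)
        (z := max (sInf (uc '' Icc T 1)) (min (sSup (uc '' Icc 0 T)) (U T)))
        ⟨(le_min h2 h).trans (le_max_right _ _),
          max_le (h1.trans h) (min_le_right _ _)⟩
      rwa [min_eq_right hm] at this
end

section
/- Let C assign to each T ∈ [0,1] a nonempty compact set C(T) ⊆ ℝ² such that T ≤ T' implies C(T) ⊆ C(T'). Define lf(T) = min{u : (u,v) ∈ C(T)}, uf(T) = max{u : (u,v) ∈ C(T)}, and V(T,u) = sup{v : (u,v) ∈ conv(C(T))}. Let U : [0,1] → ℝ be weakly increasing with lf(T) ≤ U(T) ≤ uf(T) for all T, and suppose the map W(T) = V(T, U(T)) is real-valued and upper semicontinuous on [0,1]. Then there exists a weakly increasing Û : [0,1] → ℝ with lf(T) ≤ Û(T) ≤ uf(T) for all T, such that for all 0 ≤ s ≤ T ≤ 1 one has V(T, Û(T)) ≥ V(s, U(s)); in particular V(T, Û(T)) ≥ V(T, U(T)) for every T. -/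
open Set

/-- A smallest maximizer of `W` on `[0,T]` exists. -/
lemma exists_first_max (W : ℝ → ℝ) (hW : UpperSemicontinuousOn W (Icc (0:ℝ) 1))
    (T : ℝ) (hT : T ∈ Icc (0:ℝ) 1) :
    ∃ a ∈ Icc 0 T, (∀ r ∈ Icc 0 T, W r ≤ W a) ∧
      ∀ b ∈ Icc 0 T, W a ≤ W b → a ≤ b := by
  have hW' : UpperSemicontinuousOn W (Icc 0 T) := hW.mono (Icc_subset_Icc le_rfl hT.2)
  obtain ⟨m, hm, hmax⟩ := hW'.exists_isMaxOn ⟨0, left_mem_Icc.2 hT.1⟩ isCompact_Icc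
  obtain ⟨a, ha, hleast⟩ :=
    (hW'.isCompact_inter_preimage_Ici isCompact_Icc (W m)).exists_isLeast
      ⟨m, hm, le_refl (W m)⟩
  refine ⟨a, ha.1, fun r hr => le_trans (hmax hr) ha.2, fun b hb hab => hleast ⟨hb, ?_⟩⟩
  exact le_trans ha.2 hab

/-- Every utility between the extreme ones is attained on the convex hull. -/
lemma exists_mem_hull (K : Set (ℝ × ℝ)) (hne : K.Nonempty) (hK : IsCompact K) (u : ℝ)
    (h1 : sInf (Prod.fst '' K) ≤ u) (h2 : u ≤ sSup (Prod.fst '' K)) :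
    {v : ℝ | (u, v) ∈ convexHull ℝ K}.Nonempty := by
  have hc : IsCompact (Prod.fst '' K) := hK.image continuous_fst
  have hn : (Prod.fst '' K).Nonempty := hne.image _
  have hmem : u ∈ convexHull ℝ (Prod.fst '' K) :=
    (convex_convexHull ℝ (Prod.fst '' K)).ordConnected.out
      (subset_convexHull ℝ _ (hc.sInf_mem hn)) (subset_convexHull ℝ _ (hc.sSup_mem hn)) ⟨h1, h2⟩
  have himg := LinearMap.image_convexHull (LinearMap.fst ℝ ℝ ℝ) K
  rw [LinearMap.coe_fst] at himg
  rw [← himg] at hmem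
  obtain ⟨⟨x, v⟩, hp, rfl⟩ := hmem
  exact ⟨v, hp⟩

lemma bddAbove_hull (K : Set (ℝ × ℝ)) (hK : IsCompact K) (u : ℝ) :
    BddAbove {v : ℝ | (u, v) ∈ convexHull ℝ K} := by
  have hb : Bornology.IsBounded (convexHull ℝ K) := isBounded_convexHull.2 hK.isBounded
  refine (hb.image_snd.bddAbove).mono ?_
  intro v hv
  exact ⟨(u, v), hv, rfl⟩

/-- Monotone interim principal payoff: Given a monotone family of
nonempty compact choice sets `C(T) ⊆ ℝ²` for `T ∈ [0,1]`, with feasibility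
bounds `lf(T) = min{u : (u,v) ∈ C(T)}`, `uf(T) = max{u : (u,v) ∈ C(T)}` and
principal value `V(T,u) = sup{v : (u,v) ∈ conv(C(T))}`, any weakly increasing
feasible promised utility `U` whose induced principal payoff is upper
semicontinuous can be replaced by a weakly increasing feasible `Û` whose
induced principal payoff is the running maximum of that of `U`; in particular
`V(T, Û(T)) ≥ V(T, U(T))` for every `T`. -/
theorem stmt11 (C : ℝ → Set (ℝ × ℝ))
    (hne : ∀ T ∈ Icc (0:ℝ) 1, (C T).Nonempty)
    (hcpt : ∀ T ∈ Icc (0:ℝ) 1, IsCompact (C T))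
    (hmono : ∀ T ∈ Icc (0:ℝ) 1, ∀ T' ∈ Icc (0:ℝ) 1, T ≤ T' → C T ⊆ C T')
    (U : ℝ → ℝ) (hUmono : MonotoneOn U (Icc (0:ℝ) 1))
    (hUfeas : ∀ T ∈ Icc (0:ℝ) 1,
      sInf (Prod.fst '' C T) ≤ U T ∧ U T ≤ sSup (Prod.fst '' C T))
    (hWusc : UpperSemicontinuousOn
      (fun T => sSup {v : ℝ | (U T, v) ∈ convexHull ℝ (C T)}) (Icc (0:ℝ) 1)) :
    ∃ Uh : ℝ → ℝ,
      MonotoneOn Uh (Icc (0:ℝ) 1) ∧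
      (∀ T ∈ Icc (0:ℝ) 1,
        sInf (Prod.fst '' C T) ≤ Uh T ∧ Uh T ≤ sSup (Prod.fst '' C T)) ∧
      (∀ s ∈ Icc (0:ℝ) 1, ∀ T ∈ Icc (0:ℝ) 1, s ≤ T →
        sSup {v : ℝ | (U s, v) ∈ convexHull ℝ (C s)}
          ≤ sSup {v : ℝ | (Uh T, v) ∈ convexHull ℝ (C T)}) ∧
      (∀ T ∈ Icc (0:ℝ) 1,
        sSup {v : ℝ | (U T, v) ∈ convexHull ℝ (C T)}
          ≤ sSup {v : ℝ | (Uh T, v) ∈ convexHull ℝ (C T)}) := by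
  set W : ℝ → ℝ := fun T => sSup {v : ℝ | (U T, v) ∈ convexHull ℝ (C T)} with hWdef
  choose! a ha hmax hleast using exists_first_max W hWusc
  have ha01 : ∀ T ∈ Icc (0:ℝ) 1, a T ∈ Icc (0:ℝ) 1 := fun T hT =>
    ⟨(ha T hT).1, (ha T hT).2.trans hT.2⟩
  have key : ∀ s ∈ Icc (0:ℝ) 1, ∀ T ∈ Icc (0:ℝ) 1, s ≤ T →
      sSup {v : ℝ | (U s, v) ∈ convexHull ℝ (C s)}
        ≤ sSup {v : ℝ | (U (a T), v) ∈ convexHull ℝ (C T)} := by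
    intro s hs T hT hsT
    have hA := ha01 T hT
    refine le_trans (hmax T hT s ⟨hs.1, hsT⟩) ?_
    refine csSup_le_csSup (bddAbove_hull _ (hcpt T hT) _)
      (exists_mem_hull _ (hne _ hA) (hcpt _ hA) _ (hUfeas _ hA).1 (hUfeas _ hA).2) ?_
    intro v hv
    exact convexHull_mono (hmono _ hA _ hT (ha T hT).2) hv
  refine ⟨fun T => U (a T), ?_, ?_, key, fun T hT => key T hT T hT le_rfl⟩
  · intro T hT T' hT' hTT'
    refine hUmono (ha01 T hT) (ha01 T' hT') ?_
    by_cases h : a T' ≤ T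
    · refine hleast T hT _ ⟨(ha T' hT').1, h⟩ ?_
      exact hmax T' hT' _ ⟨(ha T hT).1, (ha T hT).2.trans hTT'⟩
    · exact (ha T hT).2.trans (not_le.1 h).le
  · intro T hT
    have hA := ha01 T hT
    have hsub : Prod.fst '' C (a T) ⊆ Prod.fst '' C T :=
      image_mono (hmono _ hA _ hT (ha T hT).2)
    have hn : (Prod.fst '' C (a T)).Nonempty := (hne _ hA).image _
    have hc : IsCompact (Prod.fst '' C T) := (hcpt T hT).image continuous_fst
    exact ⟨(csInf_le_csInf hc.bddBelow hn hsub).trans (hUfeas _ hA).1,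
      (hUfeas _ hA).2.trans (csSup_le_csSup hc.bddAbove hn hsub)⟩
end

section
/- Let lf, uf : [0,1] → ℝ with lf weakly decreasing and uf weakly increasing, let V : [0,1] → ℝ → ℝ be bounded, and call U : [0,1] → ℝ admissible if U is weakly increasing and lf(T) ≤ U(T) ≤ uf(T) for all T. For a Borel probability measure G on [0,1], define OPT(G) as the supremum, over all admissible U such that T ↦ V(T, U(T)) is G-integrable, of ∫ V(T, U(T)) dG(T). Let F and F̂ be Borel probability measures on [0,1] with F̂([0,t]) ≤ F([0,t]) for every t ∈ [0,1] (first-order stochastic dominance). Suppose there exists an admissible U* such that T ↦ V(T, U*(T)) is weakly increasing and ∫ V(T, U*(T)) dF(T) = OPT(F). Then OPT(F̂) ≥ OPT(F). -/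
open Set MeasureTheory

/-- The principal's optimal value under distribution `G`: the supremum over all
admissible promised utilities `U` (weakly increasing on `[0,1]` with
`lf ≤ U ≤ uf` there) such that `T ↦ V(T, U(T))` is `G`-integrable, of
`∫ V(T, U(T)) dG(T)`. -/
noncomputable def OPTdist (lf uf : ℝ → ℝ) (V : ℝ → ℝ → ℝ) (G : Measure ℝ) : ℝ :=
  sSup {x : ℝ | ∃ U : ℝ → ℝ,
    MonotoneOn U (Icc (0:ℝ) 1) ∧
    (∀ T ∈ Icc (0:ℝ) 1, lf T ≤ U T ∧ U T ≤ uf T) ∧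
    Integrable (fun T => V T (U T)) G ∧
    x = ∫ T, V T (U T) ∂G}

lemma aux_Iic (F Fhat : Measure ℝ) [IsProbabilityMeasure F] [IsProbabilityMeasure Fhat]
    (hF : F (Icc (0:ℝ) 1) = 1) (hG : Fhat (Icc (0:ℝ) 1) = 1)
    (h : ∀ t ∈ Icc (0:ℝ) 1, Fhat (Icc 0 t) ≤ F (Icc 0 t)) (a : ℝ) :
    Fhat (Iic a) ≤ F (Iic a) := by
  have hGc : Fhat (Icc (0:ℝ) 1)ᶜ = 0 := (prob_compl_eq_zero_iff measurableSet_Icc).2 hG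
  rcases lt_or_ge a 0 with h0 | h0
  · have hsub : Iic a ⊆ (Icc (0:ℝ) 1)ᶜ := by
      intro x hx hx'
      exact absurd (hx'.1.trans (mem_Iic.1 hx)) (not_le.2 h0)
    have : Fhat (Iic a) = 0 := measure_mono_null hsub hGc
    simp [this]
  rcases le_or_gt a 1 with h1 | h1
  · calc Fhat (Iic a) ≤ Fhat (Icc 0 a ∪ (Icc (0:ℝ) 1)ᶜ) := measure_mono (fun x hx => by
          by_cases h0x : 0 ≤ x
          · exact Or.inl ⟨h0x, hx⟩
          · exact Or.inr (fun h' => h0x h'.1))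
      _ ≤ Fhat (Icc 0 a) + Fhat (Icc (0:ℝ) 1)ᶜ := measure_union_le _ _
      _ = Fhat (Icc 0 a) := by rw [hGc, add_zero]
      _ ≤ F (Icc 0 a) := h a ⟨h0, h1⟩
      _ ≤ F (Iic a) := measure_mono Icc_subset_Iic_self
  · calc Fhat (Iic a) ≤ 1 := prob_le_one
      _ = F (Icc 0 1) := hF.symm
      _ ≤ F (Iic a) := measure_mono (fun x hx => le_trans hx.2 h1.le)

lemma aux_lower (F Fhat : Measure ℝ) [IsProbabilityMeasure F] [IsProbabilityMeasure Fhat]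
    (h : ∀ a, Fhat (Iic a) ≤ F (Iic a)) (L : Set ℝ) (hL : IsLowerSet L)
    (hm : MeasurableSet L) : Fhat L ≤ F L := by
  rw [hm.measure_eq_iSup_isCompact]
  refine iSup_le fun K => iSup_le fun hKL => iSup_le fun hK => ?_
  rcases K.eq_empty_or_nonempty with rfl | hne
  · simp
  obtain ⟨a, ha⟩ := hK.exists_isGreatest hne
  calc Fhat K ≤ Fhat (Iic a) := measure_mono (fun x hx => ha.2 hx)
    _ ≤ F (Iic a) := h a
    _ ≤ F L := measure_mono (fun x hx => hL hx (hKL ha.1))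

lemma aux_int (F Fhat : Measure ℝ) [IsProbabilityMeasure F] [IsProbabilityMeasure Fhat]
    (h : ∀ a, Fhat (Iic a) ≤ F (Iic a)) (g : ℝ → ℝ) (hg : Monotone g) (h0 : ∀ x, 0 ≤ g x)
    (hi : Integrable g Fhat) : ∫ x, g x ∂F ≤ ∫ x, g x ∂Fhat := by
  have hmeas : Measurable g := hg.measurable
  rw [integral_eq_lintegral_of_nonneg_ae (Filter.Eventually.of_forall h0)
      hmeas.aestronglyMeasurable,
    integral_eq_lintegral_of_nonneg_ae (Filter.Eventually.of_forall h0)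
      hmeas.aestronglyMeasurable]
  refine ENNReal.toReal_mono hi.lintegral_lt_top.ne ?_
  rw [lintegral_eq_lintegral_meas_lt F (Filter.Eventually.of_forall h0) hmeas.aemeasurable,
    lintegral_eq_lintegral_meas_lt Fhat (Filter.Eventually.of_forall h0) hmeas.aemeasurable]
  refine lintegral_mono fun t => ?_
  have hS : MeasurableSet {x | g x ≤ t} := measurableSet_le hmeas measurable_const
  have hc : {x | t < g x} = {x | g x ≤ t}ᶜ := by ext x; simp
  have hl := aux_lower F Fhat h {x | g x ≤ t} (fun a b hab ha => (hg hab).trans ha) hS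
  simp only [hc]
  rw [prob_compl_eq_one_sub hS, prob_compl_eq_one_sub hS]
  exact tsub_le_tsub_left hl 1

/-- If `F̂` first-order stochastically dominates `F` (both Borel
probability measures on `[0,1]`) and there is an optimal admissible promised
utility `U*` for `F` whose induced principal payoff `T ↦ V(T, U*(T))` is weakly
increasing, then the principal's optimal value is weakly higher under `F̂`. -/
theorem stmt12 (lf uf : ℝ → ℝ)
    (hlf : AntitoneOn lf (Icc (0:ℝ) 1)) (huf : MonotoneOn uf (Icc (0:ℝ) 1))
    (V : ℝ → ℝ → ℝ) (hVbdd : ∃ M : ℝ, ∀ T u : ℝ, |V T u| ≤ M)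
    (F Fhat : Measure ℝ) [IsProbabilityMeasure F] [IsProbabilityMeasure Fhat]
    (hFsupp : F (Icc (0:ℝ) 1) = 1) (hFhatsupp : Fhat (Icc (0:ℝ) 1) = 1)
    (hFOSD : ∀ t ∈ Icc (0:ℝ) 1, Fhat (Icc 0 t) ≤ F (Icc 0 t))
    (Ustar : ℝ → ℝ)
    (hUmono : MonotoneOn Ustar (Icc (0:ℝ) 1))
    (hUfeas : ∀ T ∈ Icc (0:ℝ) 1, lf T ≤ Ustar T ∧ Ustar T ≤ uf T)
    (hVUmono : MonotoneOn (fun T => V T (Ustar T)) (Icc (0:ℝ) 1))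
    (hUint : Integrable (fun T => V T (Ustar T)) F)
    (hUopt : (∫ T, V T (Ustar T) ∂F) = OPTdist lf uf V F) :
    OPTdist lf uf V F ≤ OPTdist lf uf V Fhat := by
  obtain ⟨M, hM⟩ := hVbdd
  set f : ℝ → ℝ := fun T => V T (Ustar T) with hf
  set e : ℝ → ℝ := fun T => f (projIcc (0:ℝ) 1 zero_le_one T) with he
  have hemono : Monotone e := fun a b hab =>
    hVUmono (projIcc (0:ℝ) 1 zero_le_one a).2 (projIcc (0:ℝ) 1 zero_le_one b).2
      (monotone_projIcc _ hab)
  have hae : ∀ (μ : Measure ℝ) [IsProbabilityMeasure μ], μ (Icc (0:ℝ) 1) = 1 → e =ᵐ[μ] f := by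
    intro μ _ hμ
    have hc : ∀ᵐ x ∂μ, x ∈ Icc (0:ℝ) 1 := (prob_compl_eq_zero_iff measurableSet_Icc).2 hμ
    filter_upwards [hc] with x hx
    simp only [he, projIcc_of_mem zero_le_one hx]
  have hei : ∀ (μ : Measure ℝ) [IsProbabilityMeasure μ], Integrable e μ := by
    intro μ _
    exact Integrable.of_bound hemono.measurable.aestronglyMeasurable M
      (Filter.Eventually.of_forall fun x => hM _ _)
  have key := aux_int F Fhat (aux_Iic F Fhat hFsupp hFhatsupp hFOSD) (fun x => e x + M)
    (fun a b hab => by have := hemono hab; dsimp only; linarith)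
    (fun x => by have := (abs_le.1 (hM _ _ : |e x| ≤ M)).1; linarith)
    ((hei Fhat).add (integrable_const M))
  rw [integral_add (hei F) (integrable_const M),
    integral_add (hei Fhat) (integrable_const M), integral_congr_ae (hae F hFsupp),
    integral_congr_ae (hae Fhat hFhatsupp)] at key
  simp only [integral_const, probReal_univ, add_le_add_iff_right] at key
  rw [← hUopt]
  refine key.trans (le_csSup ⟨M, ?_⟩
    ⟨Ustar, hUmono, hUfeas, (hei Fhat).congr (hae Fhat hFhatsupp), rfl⟩)
  rintro x ⟨U, -, -, -, rfl⟩
  have := norm_integral_le_of_norm_le_const (μ := Fhat) (f := fun T => V T (U T)) (C := M)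
    (Filter.Eventually.of_forall fun x => hM _ _)
  simp only [probReal_univ, mul_one] at this
  exact (le_abs_self _).trans this
end

section
/- Let a ≤ b be real numbers and let g, h : ℝ → ℝ with g weakly increasing on [a,b] and h weakly decreasing on [a,b]. For q ∈ [0,1] define f_q(u) = (1-q)·g(u) + q·h(u). Suppose 0 ≤ q ≤ q' ≤ 1, u ∈ [a,b] maximizes f_q over [a,b], and u' ∈ [a,b] maximizes f_{q'} over [a,b]. Then min(u,u') maximizes f_{q'} over [a,b] and max(u,u') maximizes f_q over [a,b]. -/
open Set

/-- monotone comparative statics: Let `g` be weakly increasing and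
`h` weakly decreasing on `[a,b]`, and for `q ∈ [0,1]` set
`f_q(u) = (1-q)·g(u) + q·h(u)`. If `0 ≤ q ≤ q' ≤ 1`, `u` maximizes `f_q` over
`[a,b]`, and `u'` maximizes `f_{q'}` over `[a,b]`, then `min(u,u')` maximizes
`f_{q'}` over `[a,b]` and `max(u,u')` maximizes `f_q` over `[a,b]`. -/
theorem stmt14 (a b : ℝ) (hab : a ≤ b) (g h : ℝ → ℝ)
    (hg : MonotoneOn g (Icc a b)) (hh : AntitoneOn h (Icc a b))
    (q q' : ℝ) (hq0 : 0 ≤ q) (hqq' : q ≤ q') (hq'1 : q' ≤ 1)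
    (u u' : ℝ) (hu : u ∈ Icc a b) (hu' : u' ∈ Icc a b)
    (hmaxq : ∀ w ∈ Icc a b, (1 - q) * g w + q * h w ≤ (1 - q) * g u + q * h u)
    (hmaxq' : ∀ w ∈ Icc a b,
      (1 - q') * g w + q' * h w ≤ (1 - q') * g u' + q' * h u') :
    (min u u' ∈ Icc a b ∧
      ∀ w ∈ Icc a b,
        (1 - q') * g w + q' * h w ≤ (1 - q') * g (min u u') + q' * h (min u u')) ∧
    (max u u' ∈ Icc a b ∧
      ∀ w ∈ Icc a b,
        (1 - q) * g w + q * h w ≤ (1 - q) * g (max u u') + q * h (max u u')) := by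
  rcases le_total u u' with hle | hle
  · rw [min_eq_left hle, max_eq_right hle]
    have h1 := hg hu hu' hle
    have h2 := hh hu hu' hle
    have h3 : 0 ≤ (q' - q) * ((h u - h u') + (g u' - g u)) :=
      mul_nonneg (by linarith) (by linarith)
    have h4 := hmaxq u' hu'
    have h5 := hmaxq' u hu
    refine ⟨⟨hu, fun w hw => ?_⟩, ⟨hu', fun w hw => ?_⟩⟩
    · have h6 := hmaxq' w hw
      linarith
    · have h6 := hmaxq w hw
      linarith
  · rw [min_eq_right hle, max_eq_left hle]
    exact ⟨⟨hu', hmaxq'⟩, ⟨hu, hmaxq⟩⟩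
end

section
/- Let lf, uf : [0,1] → ℝ with lf weakly decreasing and uf weakly increasing; let u_c : [0,1] → ℝ be continuous with lf(T) ≤ u_c(T) ≤ uf(T) for all T; let V : [0,1] × ℝ → ℝ be continuous and bounded, such that for every T ∈ [0,1], the map u ↦ V(T,u) is concave on [lf(T), uf(T)] and satisfies V(T, u_c(T)) ≥ V(T,u) for all u ∈ [lf(T), uf(T)]. Let F be a Borel probability measure on [0,1]. Call U : [0,1] → ℝ admissible if U is weakly increasing and lf(T) ≤ U(T) ≤ uf(T) for all T, and call an admissible U* optimal if ∫ V(T, U*(T)) dF(T) ≥ ∫ V(T, U(T)) dF(T) for every admissible U. Suppose an optimal admissible U* exists. Then there exists an optimal admissible U such that for every T ∈ [0,1] with U(T) ≠ u_c(T), there exist T1 < T2 in [0,1] with T1 ≤ T ≤ T2 such that U is constant on [T1, T2]. -/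
open Set MeasureTheory

lemma aux_sup (W g : ℝ → ℝ) (hg : MonotoneOn g (Icc (0:ℝ) 1))
    (hW : ∀ T ∈ Icc (0:ℝ) 1, W T ≤ g T) :
    ∃ R : ℝ → ℝ, (∀ T ∈ Icc (0:ℝ) 1, ∀ s ∈ Icc (0:ℝ) T, W s ≤ R T) ∧
      (∀ T ∈ Icc (0:ℝ) 1, ∀ b, (∀ s ∈ Icc (0:ℝ) T, W s ≤ b) → R T ≤ b) := by
  refine ⟨fun T => sSup (W '' Icc 0 T), ?_, ?_⟩
  · intro T hT s hs
    refine le_csSup ⟨g T, ?_⟩ (mem_image_of_mem W hs)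
    rintro _ ⟨x, hx, rfl⟩
    have hx' : x ∈ Icc (0:ℝ) 1 := ⟨hx.1, hx.2.trans hT.2⟩
    exact (hW x hx').trans (hg hx' hT hx.2)
  · intro T hT b hb
    refine csSup_le ⟨W 0, mem_image_of_mem W ⟨le_rfl, hT.1⟩⟩ ?_
    rintro _ ⟨x, hx, rfl⟩
    exact hb x hx

lemma aux_inf (W g : ℝ → ℝ) (hg : MonotoneOn g (Icc (0:ℝ) 1))
    (hW : ∀ T ∈ Icc (0:ℝ) 1, g T ≤ W T) :
    ∃ R : ℝ → ℝ, (∀ T ∈ Icc (0:ℝ) 1, ∀ s ∈ Icc T 1, R T ≤ W s) ∧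
      (∀ T ∈ Icc (0:ℝ) 1, ∀ b, (∀ s ∈ Icc T 1, b ≤ W s) → b ≤ R T) := by
  refine ⟨fun T => sInf (W '' Icc T 1), ?_, ?_⟩
  · intro T hT s hs
    refine csInf_le ⟨g T, ?_⟩ (mem_image_of_mem W hs)
    rintro _ ⟨x, hx, rfl⟩
    have hx' : x ∈ Icc (0:ℝ) 1 := ⟨hT.1.trans hx.1, hx.2⟩
    exact (hg hT hx' hx.1).trans (hW x hx')
  · intro T hT b hb
    refine le_csInf ⟨W 1, mem_image_of_mem W ⟨hT.2, le_rfl⟩⟩ ?_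
    rintro _ ⟨x, hx, rfl⟩
    exact hb x hx

lemma aux_nhd (p : ℝ → Prop) (T : ℝ) (hT : T ∈ Icc (0:ℝ) 1)
    (h : ∀ᶠ x in nhdsWithin T (Icc (0:ℝ) 1), p x) :
    ∃ T1 T2 : ℝ, T1 ∈ Icc (0:ℝ) 1 ∧ T2 ∈ Icc (0:ℝ) 1 ∧ T1 < T2 ∧
      T1 ≤ T ∧ T ≤ T2 ∧ ∀ x ∈ Icc T1 T2, p x := by
  obtain ⟨d, hd, hp⟩ := Metric.mem_nhdsWithin_iff.1 h
  obtain ⟨h0, h1⟩ := hT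
  have e1 : max 0 (T - d/2) ≤ T := max_le h0 (by linarith)
  have e2 : T ≤ min 1 (T + d/2) := le_min h1 (by linarith)
  have e3 : max 0 (T - d/2) < min 1 (T + d/2) := by
    rw [max_lt_iff, lt_min_iff, lt_min_iff]
    refine ⟨⟨?_, ?_⟩, ?_, ?_⟩ <;> linarith
  refine ⟨max 0 (T - d/2), min 1 (T + d/2), ⟨le_max_left _ _, e1.trans h1⟩,
    ⟨h0.trans e2, min_le_left _ _⟩, e3, e1, e2, ?_⟩
  intro x hx
  have a1 := (le_max_left _ _).trans hx.1
  have a2 := (le_max_right _ _).trans hx.1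
  have a3 := hx.2.trans (min_le_left _ _)
  have a4 := hx.2.trans (min_le_right _ _)
  apply hp
  refine ⟨?_, a1, a3⟩
  rw [Metric.mem_ball, Real.dist_eq, abs_lt]
  constructor <;> linarith

lemma aux_integrable (V : ℝ → ℝ → ℝ)
    (hVcont : ContinuousOn (fun p : ℝ × ℝ => V p.1 p.2) ((Icc (0:ℝ) 1) ×ˢ univ))
    (hVbdd : ∃ M : ℝ, ∀ T ∈ Icc (0:ℝ) 1, ∀ u : ℝ, |V T u| ≤ M)
    (F : Measure ℝ) [IsProbabilityMeasure F] (hF : ∀ᵐ T ∂F, T ∈ Icc (0:ℝ) 1)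
    (U : ℝ → ℝ) (hU : MonotoneOn U (Icc (0:ℝ) 1)) :
    Integrable (fun T => V T (U T)) F := by
  obtain ⟨M, hM⟩ := hVbdd
  have hc : ∀ t : ℝ, max 0 (min 1 t) ∈ Icc (0:ℝ) 1 := fun t =>
    ⟨le_max_left _ _, max_le zero_le_one (min_le_left _ _)⟩
  have hmono : Monotone (fun t : ℝ => U (max 0 (min 1 t))) := by
    intro a b hab
    exact hU (hc a) (hc b) (max_le_max le_rfl (min_le_min le_rfl hab))
  have hV : Continuous (fun p : ℝ × ℝ => V (max 0 (min 1 p.1)) p.2) := by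
    have := hVcont.comp_continuous
      (f := fun p : ℝ × ℝ => ((max 0 (min 1 p.1) : ℝ), p.2)) (by fun_prop)
      (fun p => ⟨hc p.1, mem_univ _⟩)
    exact this
  have hm : Measurable (fun t : ℝ => V (max 0 (min 1 t)) (U (max 0 (min 1 t)))) :=
    hV.measurable.comp (measurable_id.prodMk hmono.measurable)
  have hi : Integrable (fun t : ℝ => V (max 0 (min 1 t)) (U (max 0 (min 1 t)))) F :=
    Integrable.of_bound hm.aestronglyMeasurable M
      (Filter.Eventually.of_forall fun t => hM _ (hc t) _)
  refine hi.congr ?_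
  filter_upwards [hF] with t ht
  have : max 0 (min 1 t) = t := by rw [min_eq_right ht.2, max_eq_right ht.1]
  simp only [this]

lemma aux_conc (f : ℝ → ℝ) (a b : ℝ) (hf : ConcaveOn ℝ (Icc a b) f) (c x y : ℝ)
    (hc : c ∈ Icc a b) (hx : x ∈ Icc a b) (hmax : f x ≤ f c)
    (hy : (c ≤ y ∧ y ≤ x) ∨ (x ≤ y ∧ y ≤ c)) : f x ≤ f y := by
  have hs : y ∈ segment ℝ x c := by
    rw [segment_eq_uIcc, mem_uIcc]
    tauto
  have := hf.ge_on_segment hx hc hs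
  rwa [min_eq_left hmax] at this

/-- bang-bang structure of optimal mechanisms: Let `lf` be weakly
decreasing and `uf` weakly increasing on `[0,1]`, let the complete-information
curve `u_c` be continuous with `lf ≤ u_c ≤ uf` on `[0,1]`, and let `V` be a
continuous bounded principal-value function such that for each `T ∈ [0,1]`,
`u ↦ V(T,u)` is concave on `[lf(T), uf(T)]` and maximized there at `u_c(T)`.
Call `U` admissible if it is weakly increasing on `[0,1]` with `lf ≤ U ≤ uf`
there, and optimal if it maximizes `∫ V(T, U(T)) dF(T)` among admissible
promised utilities. If an optimal admissible promised utility exists, then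
there is an optimal admissible `U` such that at every type `T` where `U`
departs from the complete-information curve, `U` is constant on a
nondegenerate interval `[T1, T2] ⊆ [0,1]` around `T`. -/
theorem stmt16 (lf uf uc : ℝ → ℝ)
    (hlf : AntitoneOn lf (Icc (0:ℝ) 1)) (huf : MonotoneOn uf (Icc (0:ℝ) 1))
    (hucCont : ContinuousOn uc (Icc (0:ℝ) 1))
    (hucFeas : ∀ T ∈ Icc (0:ℝ) 1, lf T ≤ uc T ∧ uc T ≤ uf T)
    (V : ℝ → ℝ → ℝ)
    (hVcont : ContinuousOn (fun p : ℝ × ℝ => V p.1 p.2) ((Icc (0:ℝ) 1) ×ˢ univ))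
    (hVbdd : ∃ M : ℝ, ∀ T ∈ Icc (0:ℝ) 1, ∀ u : ℝ, |V T u| ≤ M)
    (hVconc : ∀ T ∈ Icc (0:ℝ) 1, ConcaveOn ℝ (Icc (lf T) (uf T)) (V T))
    (hVmax : ∀ T ∈ Icc (0:ℝ) 1, ∀ u ∈ Icc (lf T) (uf T), V T u ≤ V T (uc T))
    (F : Measure ℝ) [IsProbabilityMeasure F] (hFsupp : F (Icc (0:ℝ) 1) = 1)
    (Ustar : ℝ → ℝ)
    (hUstarAdm : MonotoneOn Ustar (Icc (0:ℝ) 1) ∧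
      ∀ T ∈ Icc (0:ℝ) 1, lf T ≤ Ustar T ∧ Ustar T ≤ uf T)
    (hUstarOpt : ∀ U : ℝ → ℝ,
      MonotoneOn U (Icc (0:ℝ) 1) →
      (∀ T ∈ Icc (0:ℝ) 1, lf T ≤ U T ∧ U T ≤ uf T) →
      (∫ T, V T (U T) ∂F) ≤ ∫ T, V T (Ustar T) ∂F) :
    ∃ U : ℝ → ℝ,
      (MonotoneOn U (Icc (0:ℝ) 1) ∧
        ∀ T ∈ Icc (0:ℝ) 1, lf T ≤ U T ∧ U T ≤ uf T) ∧
      (∀ U' : ℝ → ℝ,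
        MonotoneOn U' (Icc (0:ℝ) 1) →
        (∀ T ∈ Icc (0:ℝ) 1, lf T ≤ U' T ∧ U' T ≤ uf T) →
        (∫ T, V T (U' T) ∂F) ≤ ∫ T, V T (U T) ∂F) ∧
      (∀ T ∈ Icc (0:ℝ) 1, U T ≠ uc T →
        ∃ T1 T2 : ℝ, T1 ∈ Icc (0:ℝ) 1 ∧ T2 ∈ Icc (0:ℝ) 1 ∧ T1 < T2 ∧
          T1 ≤ T ∧ T ≤ T2 ∧
          ∀ x ∈ Icc T1 T2, ∀ y ∈ Icc T1 T2, U x = U y) := by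
  obtain ⟨hUm, hUf⟩ := hUstarAdm
  obtain ⟨U1, hA, hB⟩ := aux_sup (fun T => min (Ustar T) (uc T)) Ustar hUm
    (fun T _ => min_le_left _ _)
  have h1m : MonotoneOn U1 (Icc (0:ℝ) 1) := fun a ha b hb hab =>
    hB a ha _ fun s hs => hA b hb s ⟨hs.1, hs.2.trans hab⟩
  have h1le : ∀ T ∈ Icc (0:ℝ) 1, U1 T ≤ Ustar T := fun T hT =>
    hB T hT _ fun s hs => (min_le_left _ _).trans (hUm ⟨hs.1, hs.2.trans hT.2⟩ hT hs.2)
  have h1ge : ∀ T ∈ Icc (0:ℝ) 1, min (Ustar T) (uc T) ≤ U1 T := fun T hT =>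
    hA T hT T ⟨hT.1, le_rfl⟩
  obtain ⟨U2, hC, hD⟩ := aux_inf (fun T => max (U1 T) (uc T)) U1 h1m
    (fun T _ => le_max_left _ _)
  have h2m : MonotoneOn U2 (Icc (0:ℝ) 1) := fun a ha b hb hab =>
    hD b hb _ fun s hs => hC a ha s ⟨hab.trans hs.1, hs.2⟩
  have h2ge : ∀ T ∈ Icc (0:ℝ) 1, U1 T ≤ U2 T := fun T hT =>
    hD T hT _ fun s hs => (h1m hT ⟨hT.1.trans hs.1, hs.2⟩ hs.1).trans (le_max_left _ _)
  have h2le : ∀ T ∈ Icc (0:ℝ) 1, U2 T ≤ max (U1 T) (uc T) := fun T hT =>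
    hC T hT T ⟨le_rfl, hT.2⟩
  have h2f : ∀ T ∈ Icc (0:ℝ) 1, lf T ≤ U2 T ∧ U2 T ≤ uf T := by
    intro T hT
    constructor
    · exact (le_min (hUf T hT).1 (hucFeas T hT).1).trans ((h1ge T hT).trans (h2ge T hT))
    · exact (h2le T hT).trans (max_le ((h1le T hT).trans (hUf T hT).2) (hucFeas T hT).2)
  have hF : ∀ᵐ T ∂F, T ∈ Icc (0:ℝ) 1 := by
    rw [← prob_compl_eq_zero_iff measurableSet_Icc] at hFsupp
    exact hFsupp
  refine ⟨U2, ⟨h2m, h2f⟩, ?_, ?_⟩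
  · intro U' hm' hf'
    refine (hUstarOpt U' hm' hf').trans ?_
    refine integral_mono_ae (aux_integrable V hVcont hVbdd F hF Ustar hUm)
      (aux_integrable V hVcont hVbdd F hF U2 h2m) ?_
    filter_upwards [hF] with T hT
    refine aux_conc (V T) _ _ (hVconc T hT) (uc T) _ _ (hucFeas T hT) (hUf T hT)
      (hVmax T hT _ (hUf T hT)) ?_
    have e1 := h1le T hT
    have e2 := h1ge T hT
    have e3 := h2ge T hT
    have e4 := h2le T hT
    rcases le_total (uc T) (Ustar T) with h | h
    · left
      rw [min_eq_right h] at e2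
      rw [max_eq_left e2] at e4
      exact ⟨e2.trans e3, e4.trans e1⟩
    · right
      rw [min_eq_left h] at e2
      rw [max_eq_right (e1.trans h)] at e4
      exact ⟨e2.trans e3, e4⟩
  · intro T hT hne
    rcases lt_or_gt_of_ne hne with hlt | hgt
    · have hev : ∀ᶠ x in nhdsWithin T (Icc (0:ℝ) 1), (U2 T + uc T) / 2 < uc x :=
        (hucCont T hT).eventually_const_lt (by linarith)
      obtain ⟨T1, T2, m1, m2, h12, hl, hr, hp⟩ := aux_nhd _ T hT hev
      refine ⟨T1, T2, m1, m2, h12, hl, hr, ?_⟩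
      have key : ∀ x ∈ Icc T1 T2, U2 x = U2 T := by
        intro x hx
        have hxI : x ∈ Icc (0:ℝ) 1 := ⟨m1.1.trans hx.1, hx.2.trans m2.2⟩
        rcases le_total x T with h | h
        · refine le_antisymm (h2m hxI hT h) (hD x hxI _ fun s hs => ?_)
          rcases le_total s T with h' | h'
          · have := hp s ⟨hx.1.trans hs.1, h'.trans hr⟩
            exact le_max_of_le_right (by linarith)
          · exact hC T hT s ⟨h', hs.2⟩
        · refine le_antisymm ?_ (h2m hT hxI h)
          by_contra hcon
          push Not at hcon
          have : min (U2 x) ((U2 T + uc T) / 2) ≤ U2 T := by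
            refine hD T hT _ fun s hs => ?_
            rcases le_total s x with h' | h'
            · have := hp s ⟨hl.trans hs.1, h'.trans hx.2⟩
              exact (min_le_right _ _).trans (le_max_of_le_right this.le)
            · exact (min_le_left _ _).trans (hC x hxI s ⟨h', hs.2⟩)
          rcases min_le_iff.1 this with h3 | h3 <;> linarith
      intro x hx y hy
      rw [key x hx, key y hy]
    · have h1T : uc T < U1 T := by
        rcases lt_max_iff.1 (hgt.trans_le (h2le T hT)) with h | h
        · exact h
        · exact absurd h (lt_irrefl _)
      have hev : ∀ᶠ x in nhdsWithin T (Icc (0:ℝ) 1), uc x < (U1 T + uc T) / 2 :=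
        (hucCont T hT).eventually_lt_const (by linarith)
      obtain ⟨T1, T2, m1, m2, h12, hl, hr, hp⟩ := aux_nhd _ T hT hev
      refine ⟨T1, T2, m1, m2, h12, hl, hr, ?_⟩
      have key : ∀ x ∈ Icc T1 T2, U1 x = U1 T := by
        intro x hx
        have hxI : x ∈ Icc (0:ℝ) 1 := ⟨m1.1.trans hx.1, hx.2.trans m2.2⟩
        rcases le_total x T with h | h
        · refine le_antisymm (h1m hxI hT h) ?_
          by_contra hcon
          push Not at hcon
          have : U1 T ≤ max (U1 x) ((U1 T + uc T) / 2) := by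
            refine hB T hT _ fun s hs => ?_
            rcases le_total s x with h' | h'
            · exact (hA x hxI s ⟨hs.1, h'⟩).trans (le_max_left _ _)
            · have := hp s ⟨hx.1.trans h', hs.2.trans hr⟩
              exact (min_le_right _ _).trans (le_max_of_le_right this.le)
          rcases le_max_iff.1 this with h3 | h3 <;> linarith
        · refine le_antisymm (hB x hxI _ fun s hs => ?_) (h1m hT hxI h)
          rcases le_total s T with h' | h'
          · exact hA T hT s ⟨hs.1, h'⟩
          · have := hp s ⟨hl.trans h', hs.2.trans hx.2⟩
            exact min_le_of_right_le (by linarith)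
      have key2 : ∀ x ∈ Icc T1 T2, U2 x = U1 T := by
        intro x hx
        have hxI : x ∈ Icc (0:ℝ) 1 := ⟨m1.1.trans hx.1, hx.2.trans m2.2⟩
        have e1 := key x hx
        have e2 := hp x hx
        have e3 := h2ge x hxI
        have e4 := h2le x hxI
        rw [max_eq_left (by linarith)] at e4
        linarith
      intro x hx y hy
      rw [key2 x hx, key2 y hy]
end
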